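/- If the curvature κ of α is positive at some point x₀, then the Frenet frame {T, N, B} of α is not a non-rotating frame: the Fermi–Walker derivative of the principal normal N satisfies ∇̃_T N(x₀) = τ(x₀)B(x₀) + κ(x₀)T(x₀) ≠ 0, so N is not Fermi–Walker transported. -/

import Mathlib

/-- The Galilean scalar product on `ℝ³`: `v₁w₁` if `v₁ ≠ 0` or `w₁ ≠ 0`,
and `v₂w₂ + v₃w₃` if `v₁ = 0` and `w₁ = 0`. -/
noncomputable def gProd (v w : Fin 3 → ℝ) : ℝ :=
  if v 0 ≠ 0 ∨ w 0 ≠ 0 then v 0 * w 0 else v 1 * w 1 + v 2 * w 2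

/-- The admissible curve `α(x) = (x, y(x), z(x))` in Galilean 3-space. -/
noncomputable def curve (y z : ℝ → ℝ) : ℝ → Fin 3 → ℝ :=
  fun x => ![x, y x, z x]

/-- The Fermi–Walker derivative along `α = curve y z`:
`∇̃_T X = X' − ⟨T,X⟩A + ⟨A,X⟩T`, where `T = α'` and `A = T' = α''`. -/
noncomputable def FW (y z : ℝ → ℝ) (X : ℝ → Fin 3 → ℝ) (x : ℝ) : Fin 3 → ℝ :=
  deriv X x
    - gProd (deriv (curve y z) x) (X x) • deriv (deriv (curve y z)) x
    + gProd (deriv (deriv (curve y z)) x) (X x) • deriv (curve y z) x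

/-- The tangent `T = α' = (1, y', z')`. -/
noncomputable def Tvec (y z : ℝ → ℝ) (x : ℝ) : Fin 3 → ℝ :=
  ![1, deriv y x, deriv z x]

/-- The curvature `κ = √(y''² + z''²)`. -/
noncomputable def kappa (y z : ℝ → ℝ) (x : ℝ) : ℝ :=
  Real.sqrt (deriv (deriv y) x ^ 2 + deriv (deriv z) x ^ 2)

/-- The principal normal `N = (1/κ)(0, y'', z'')`. -/
noncomputable def Nvec (y z : ℝ → ℝ) (x : ℝ) : Fin 3 → ℝ :=
  (kappa y z x)⁻¹ • ![0, deriv (deriv y) x, deriv (deriv z) x]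

/-- The binormal `B = (1/κ)(0, −z'', y'')`. -/
noncomputable def Bvec (y z : ℝ → ℝ) (x : ℝ) : Fin 3 → ℝ :=
  (kappa y z x)⁻¹ • ![0, -deriv (deriv z) x, deriv (deriv y) x]

/-- The torsion `τ = det(α', α'', α''') / κ²`. -/
noncomputable def tors (y z : ℝ → ℝ) (x : ℝ) : ℝ :=
  (Matrix.of ![![(1 : ℝ), deriv y x, deriv z x],
    ![0, deriv (deriv y) x, deriv (deriv z) x],
    ![0, deriv (deriv (deriv y)) x, deriv (deriv (deriv z)) x]]).det / kappa y z x ^ 2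

/-- A curve `(f, g, h)` in `ℝ³` is differentiated componentwise. -/
theorem hasDerivAt_vec3 {f g h : ℝ → ℝ} {a b c x : ℝ} (hf : HasDerivAt f a x)
    (hg : HasDerivAt g b x) (hh : HasDerivAt h c x) :
    HasDerivAt (fun t => ![f t, g t, h t]) ![a, b, c] x := by
  rw [hasDerivAt_pi]
  intro i
  fin_cases i
  · exact hf
  · exact hg
  · exact hh

theorem deriv_curve {y z : ℝ → ℝ} (hy : Differentiable ℝ y) (hz : Differentiable ℝ z) :
    deriv (curve y z) = Tvec y z :=
  funext fun x => (hasDerivAt_vec3 (hasDerivAt_id x) (hy x).hasDerivAt (hz x).hasDerivAt).deriv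

theorem deriv_Tvec {y z : ℝ → ℝ} (hy : Differentiable ℝ (deriv y))
    (hz : Differentiable ℝ (deriv z)) (x : ℝ) :
    deriv (Tvec y z) x = ![0, deriv (deriv y) x, deriv (deriv z) x] :=
  (hasDerivAt_vec3 (hasDerivAt_const x 1) (hy x).hasDerivAt (hz x).hasDerivAt).deriv

theorem kappa_sq (y z : ℝ → ℝ) (x : ℝ) :
    kappa y z x ^ 2 = deriv (deriv y) x ^ 2 + deriv (deriv z) x ^ 2 :=
  Real.sq_sqrt (by positivity)

theorem tors_eq (y z : ℝ → ℝ) (x : ℝ) :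
    tors y z x = (deriv (deriv y) x * deriv (deriv (deriv z)) x
      - deriv (deriv z) x * deriv (deriv (deriv y)) x) / kappa y z x ^ 2 := by
  simp [tors, Matrix.det_fin_three]

theorem hasDerivAt_kappa {y z : ℝ → ℝ} {x : ℝ} (hy : DifferentiableAt ℝ (deriv (deriv y)) x)
    (hz : DifferentiableAt ℝ (deriv (deriv z)) x) (hκ : 0 < kappa y z x) :
    HasDerivAt (kappa y z)
      ((deriv (deriv y) x * deriv (deriv (deriv y)) x
        + deriv (deriv z) x * deriv (deriv (deriv z)) x) / kappa y z x) x := by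
  have h := ((hy.hasDerivAt.pow 2).add (hz.hasDerivAt.pow 2)).sqrt (Real.sqrt_pos.1 hκ).ne'
  refine h.congr_deriv ?_
  change _ / (2 * kappa y z x) = _
  field_simp
  norm_num
  ring

/-- The Frenet equation for the principal normal: its derivative is `τ B`. -/
theorem deriv_Nvec {y z : ℝ → ℝ} {x : ℝ} (hy : DifferentiableAt ℝ (deriv (deriv y)) x)
    (hz : DifferentiableAt ℝ (deriv (deriv z)) x) (hκ : 0 < kappa y z x) :
    deriv (Nvec y z) x = tors y z x • Bvec y z x := by
  have hv := hasDerivAt_vec3 (hasDerivAt_const x (0 : ℝ)) hy.hasDerivAt hz.hasDerivAt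
  have hN : HasDerivAt (Nvec y z) _ x := ((hasDerivAt_kappa hy hz hκ).inv hκ.ne').smul hv
  have hsq := kappa_sq y z x
  rw [hN.deriv, tors_eq]
  ext i
  fin_cases i
  · simp [Bvec]
  · simp [Bvec]
    field_simp
    rw [hsq]
    ring
  · simp [Bvec]
    field_simp
    rw [hsq]
    ring

theorem gProd_Tvec_Nvec (y z : ℝ → ℝ) (x : ℝ) : gProd (Tvec y z x) (Nvec y z x) = 0 := by
  simp [gProd, Tvec, Nvec]

theorem gProd_accel_Nvec {y z : ℝ → ℝ} {x : ℝ} (hκ : 0 < kappa y z x) :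
    gProd ![0, deriv (deriv y) x, deriv (deriv z) x] (Nvec y z x) = kappa y z x := by
  have hsq := kappa_sq y z x
  simp [gProd, Nvec]
  field_simp
  rw [hsq]

/-- If the curvature is positive at `x₀`, the Frenet frame is not
non-rotating: `∇̃_T N(x₀) = τ(x₀)B(x₀) + κ(x₀)T(x₀) ≠ 0`, so `N` is not
Fermi–Walker transported. -/
theorem frenet_frame_not_nonrotating
    (y z : ℝ → ℝ) (hy : ContDiff ℝ (⊤ : ℕ∞) y) (hz : ContDiff ℝ (⊤ : ℕ∞) z)
    (hκ : ∀ x, 0 < kappa y z x) (x₀ : ℝ) :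
    FW y z (Nvec y z) x₀
      = tors y z x₀ • Bvec y z x₀ + kappa y z x₀ • Tvec y z x₀
    ∧ FW y z (Nvec y z) x₀ ≠ 0 := by
  have dy : Differentiable ℝ y := hy.differentiable (by simp)
  have dz : Differentiable ℝ z := hz.differentiable (by simp)
  have hy1 := (contDiff_infty_iff_deriv.1 hy).2
  have hz1 := (contDiff_infty_iff_deriv.1 hz).2
  have hy2 := contDiff_infty_iff_deriv.1 hy1
  have hz2 := contDiff_infty_iff_deriv.1 hz1
  have key : FW y z (Nvec y z) x₀
      = tors y z x₀ • Bvec y z x₀ + kappa y z x₀ • Tvec y z x₀ := by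
    rw [FW, deriv_curve dy dz, deriv_Tvec hy2.1 hz2.1, gProd_Tvec_Nvec,
      gProd_accel_Nvec (hκ x₀), zero_smul, sub_zero,
      deriv_Nvec (hy2.2.differentiable (by simp) x₀) (hz2.2.differentiable (by simp) x₀) (hκ x₀)]
  refine ⟨key, fun h => (hκ x₀).ne' ?_⟩
  simpa [Bvec, Tvec] using congrFun (key.symm.trans h) 0
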